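/- arXiv:1206.4395 — 2 statements merged into one kernel-verified Lean document; each statement's English description precedes it below -/
import Mathlib

section
/- Consider the polynomial ring ℂ[y₁,x₁,h₁,y₂,y₃,x₂,x₃,h₀] with the action of the one-dimensional torus ℂ* given, for t ∈ ℂ*, by the algebra substitution y₁ ↦ t⁻²·y₁, x₁ ↦ t²·x₁, h₁ ↦ h₁, y₂ ↦ t·y₂, y₃ ↦ t⁻¹·y₃, x₂ ↦ t⁻¹·x₂, x₃ ↦ t·x₃, h₀ ↦ h₀. Then a polynomial P is fixed by this substitution for all t ∈ ℂ* if and only if P lies in the ℂ-subalgebra generated by the thirteen monomials h₁, h₀, x₁y₁, x₂y₂, x₃y₃, x₁x₂y₃, x₃y₁y₂, y₂y₃, x₂x₃, y₁y₂², y₁x₃², x₁x₂², x₁y₃². (These monomials form a Hilbert basis of the invariant ring of the maximal torus of the embedded SL(2) acting on sl(3).) -/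
open MvPolynomial

/-- Variables: `0 ↦ y₁, 1 ↦ x₁, 2 ↦ h₁, 3 ↦ y₂, 4 ↦ y₃, 5 ↦ x₂, 6 ↦ x₃, 7 ↦ h₀`. -/
noncomputable abbrev y₁ : MvPolynomial (Fin 8) ℂ := X 0
noncomputable abbrev x₁ : MvPolynomial (Fin 8) ℂ := X 1
noncomputable abbrev h₁ : MvPolynomial (Fin 8) ℂ := X 2
noncomputable abbrev y₂ : MvPolynomial (Fin 8) ℂ := X 3
noncomputable abbrev y₃ : MvPolynomial (Fin 8) ℂ := X 4
noncomputable abbrev x₂ : MvPolynomial (Fin 8) ℂ := X 5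
noncomputable abbrev x₃ : MvPolynomial (Fin 8) ℂ := X 6
noncomputable abbrev h₀ : MvPolynomial (Fin 8) ℂ := X 7

/-- The weight factors of the maximal torus of the embedded `SL(2)` acting on `sl(3)`. -/
noncomputable def torusWeight (t : ℂ) : Fin 8 → ℂ :=
  ![t⁻¹ ^ 2, t ^ 2, 1, t, t⁻¹, t⁻¹, t, 1]

/-- The substitution action of `t ∈ ℂ*` on the polynomial ring. -/
noncomputable def torusAct (t : ℂ) :
    MvPolynomial (Fin 8) ℂ →ₐ[ℂ] MvPolynomial (Fin 8) ℂ :=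
  aeval fun i => C (torusWeight t i) * X i

/-- The torus scales each monomial by the product of the weights of its variables. -/
theorem torusAct_monomial (t : ℂ) (d : Fin 8 →₀ ℕ) (c : ℂ) :
    torusAct t (monomial d c) = monomial d ((∏ i, torusWeight t i ^ d i) * c) := by
  rw [torusAct, aeval_monomial, Finsupp.prod_fintype _ _ (by simp), algebraMap_eq,
    monomial_eq, Finsupp.prod_fintype _ _ (by simp)]
  simp only [mul_pow, Finset.prod_mul_distrib, map_mul, map_prod, map_pow]
  ring

theorem coeff_torusAct (t : ℂ) (d : Fin 8 →₀ ℕ) (P : MvPolynomial (Fin 8) ℂ) :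
    coeff d (torusAct t P) = (∏ i, torusWeight t i ^ d i) * coeff d P := by
  induction P using MvPolynomial.induction_on' with
  | monomial e c =>
    rw [torusAct_monomial, coeff_monomial, coeff_monomial]
    split_ifs with h
    · rw [h]
    · rw [mul_zero]
  | add p q hp hq => rw [map_add, coeff_add, coeff_add, hp, hq, mul_add]

/-- The monomials occurring in a torus-invariant polynomial have weight zero. -/
theorem weight_eq_of_torusAct_eq {P : MvPolynomial (Fin 8) ℂ}
    (hP : ∀ t : ℂ, t ≠ 0 → torusAct t P = P) {d : Fin 8 →₀ ℕ} (hd : coeff d P ≠ 0) :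
    2 * d 1 + d 3 + d 6 = 2 * d 0 + d 4 + d 5 := by
  have h := coeff_torusAct 2 d P
  rw [hP 2 two_ne_zero, eq_comm, mul_eq_right₀ hd] at h
  simp only [Fin.prod_univ_eight, torusWeight, Matrix.cons_val, one_pow, mul_one,
    ← pow_mul, inv_pow] at h
  have h' : (2 : ℂ) ^ (2 * d 1 + d 3 + d 6) = 2 ^ (2 * d 0 + d 4 + d 5) := by
    simp only [pow_add]
    field_simp at h
    linear_combination h
  exact Nat.pow_right_injective le_rfl (by exact_mod_cast h')

/-- A multiplicative submonoid containing the minimal products of weight zero in elements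
`p` (weight `2`),
`a`, `b` (weight `1`), `q` (weight `-2`), `c`, `e` (weight `-1`) contains every product of
weight zero. -/
theorem weight_zero_product_mem {R : Type*} [CommSemiring R] (S : Submonoid R)
    {q p a c e b : R}
    (hpq : p * q ∈ S) (hea : e * a ∈ S) (hbc : b * c ∈ S) (hac : a * c ∈ S) (heb : e * b ∈ S)
    (hpec : p * e * c ∈ S) (hbqa : b * q * a ∈ S) (hqa : q * a ^ 2 ∈ S) (hqb : q * b ^ 2 ∈ S)
    (hpe : p * e ^ 2 ∈ S) (hpc : p * c ^ 2 ∈ S) (i j k l m n : ℕ)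
    (h : 2 * j + k + n = 2 * i + l + m) :
    q ^ i * p ^ j * a ^ k * c ^ l * e ^ m * b ^ n ∈ S := by
  induction hN : i + j + k + l + m + n using Nat.strong_induction_on
    generalizing i j k l m n with
  | _ N ih =>
  have descend {g : R} (hg : g ∈ S) (i' j' k' l' m' n' : ℕ)
      (hw : 2 * j' + k' + n' = 2 * i' + l' + m')
      (hlt : i' + j' + k' + l' + m' + n' < N)
      (heq : q ^ i * p ^ j * a ^ k * c ^ l * e ^ m * b ^ n =
        g * (q ^ i' * p ^ j' * a ^ k' * c ^ l' * e ^ m' * b ^ n')) :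
      q ^ i * p ^ j * a ^ k * c ^ l * e ^ m * b ^ n ∈ S :=
    heq ▸ S.mul_mem hg (ih _ hlt i' j' k' l' m' n' hw rfl)
  have h_cases : (i = 0 ∧ j = 0 ∧ k = 0 ∧ l = 0 ∧ m = 0 ∧ n = 0) ∨
      (1 ≤ j ∧ 1 ≤ i) ∨ (1 ≤ m ∧ 1 ≤ k) ∨ (1 ≤ n ∧ 1 ≤ l) ∨ (1 ≤ k ∧ 1 ≤ l) ∨
      (1 ≤ m ∧ 1 ≤ n) ∨ (1 ≤ j ∧ 1 ≤ m ∧ 1 ≤ l) ∨ (1 ≤ n ∧ 1 ≤ i ∧ 1 ≤ k) ∨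
      (1 ≤ i ∧ 2 ≤ k) ∨ (1 ≤ i ∧ 2 ≤ n) ∨ (1 ≤ j ∧ 2 ≤ m) ∨ (1 ≤ j ∧ 2 ≤ l) := by
    grind (splits := 20)
  rcases h_cases with ⟨rfl, rfl, rfl, rfl, rfl, rfl⟩ | h' | h' | h' | h' | h' | h' | h' | h' | h' |
    h' | h'
  · simp
  · obtain ⟨j, rfl⟩ := Nat.exists_eq_add_of_le h'.1
    obtain ⟨i, rfl⟩ := Nat.exists_eq_add_of_le h'.2
    exact descend hpq i j k l m n (by omega) (by omega) (by ring)
  · obtain ⟨m, rfl⟩ := Nat.exists_eq_add_of_le h'.1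
    obtain ⟨k, rfl⟩ := Nat.exists_eq_add_of_le h'.2
    exact descend hea i j k l m n (by omega) (by omega) (by ring)
  · obtain ⟨n, rfl⟩ := Nat.exists_eq_add_of_le h'.1
    obtain ⟨l, rfl⟩ := Nat.exists_eq_add_of_le h'.2
    exact descend hbc i j k l m n (by omega) (by omega) (by ring)
  · obtain ⟨k, rfl⟩ := Nat.exists_eq_add_of_le h'.1
    obtain ⟨l, rfl⟩ := Nat.exists_eq_add_of_le h'.2
    exact descend hac i j k l m n (by omega) (by omega) (by ring)
  · obtain ⟨m, rfl⟩ := Nat.exists_eq_add_of_le h'.1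
    obtain ⟨n, rfl⟩ := Nat.exists_eq_add_of_le h'.2
    exact descend heb i j k l m n (by omega) (by omega) (by ring)
  · obtain ⟨j, rfl⟩ := Nat.exists_eq_add_of_le h'.1
    obtain ⟨m, rfl⟩ := Nat.exists_eq_add_of_le h'.2.1
    obtain ⟨l, rfl⟩ := Nat.exists_eq_add_of_le h'.2.2
    exact descend hpec i j k l m n (by omega) (by omega) (by ring)
  · obtain ⟨n, rfl⟩ := Nat.exists_eq_add_of_le h'.1
    obtain ⟨i, rfl⟩ := Nat.exists_eq_add_of_le h'.2.1
    obtain ⟨k, rfl⟩ := Nat.exists_eq_add_of_le h'.2.2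
    exact descend hbqa i j k l m n (by omega) (by omega) (by ring)
  · obtain ⟨i, rfl⟩ := Nat.exists_eq_add_of_le h'.1
    obtain ⟨k, rfl⟩ := Nat.exists_eq_add_of_le h'.2
    exact descend hqa i j k l m n (by omega) (by omega) (by ring)
  · obtain ⟨i, rfl⟩ := Nat.exists_eq_add_of_le h'.1
    obtain ⟨n, rfl⟩ := Nat.exists_eq_add_of_le h'.2
    exact descend hqb i j k l m n (by omega) (by omega) (by ring)
  · obtain ⟨j, rfl⟩ := Nat.exists_eq_add_of_le h'.1
    obtain ⟨m, rfl⟩ := Nat.exists_eq_add_of_le h'.2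
    exact descend hpe i j k l m n (by omega) (by omega) (by ring)
  · obtain ⟨j, rfl⟩ := Nat.exists_eq_add_of_le h'.1
    obtain ⟨l, rfl⟩ := Nat.exists_eq_add_of_le h'.2
    exact descend hpc i j k l m n (by omega) (by omega) (by ring)

/-- A polynomial is invariant under the maximal torus of the embedded `SL(2)` acting on
`sl(3)` iff it lies in the subalgebra generated by the Hilbert basis of 13 monomials. -/
theorem torus_invariants_sl2_in_sl3 (P : MvPolynomial (Fin 8) ℂ) :
    (∀ t : ℂ, t ≠ 0 → torusAct t P = P) ↔
      P ∈ Algebra.adjoin ℂ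
        ({h₁, h₀, x₁ * y₁, x₂ * y₂, x₃ * y₃, x₁ * x₂ * y₃, x₃ * y₁ * y₂,
          y₂ * y₃, x₂ * x₃, y₁ * y₂ ^ 2, y₁ * x₃ ^ 2, x₁ * x₂ ^ 2, x₁ * y₃ ^ 2} :
          Set (MvPolynomial (Fin 8) ℂ)) := by
  constructor
  · intro hP
    rw [P.as_sum]
    refine Subalgebra.sum_mem _ fun d hd => ?_
    have hw := weight_eq_of_torusAct_eq hP (mem_support_iff.mp hd)
    rw [monomial_eq, Finsupp.prod_fintype _ _ (by simp), Fin.prod_univ_eight]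
    set A := Algebra.adjoin ℂ (_ : Set (MvPolynomial (Fin 8) ℂ))
    have hprod := weight_zero_product_mem A.toSubmonoid
      (q := y₁) (p := x₁) (a := y₂) (c := y₃) (e := x₂) (b := x₃)
      (Algebra.subset_adjoin (by simp)) (Algebra.subset_adjoin (by simp))
      (Algebra.subset_adjoin (by simp)) (Algebra.subset_adjoin (by simp))
      (Algebra.subset_adjoin (by simp)) (Algebra.subset_adjoin (by simp))
      (Algebra.subset_adjoin (by simp)) (Algebra.subset_adjoin (by simp))
      (Algebra.subset_adjoin (by simp)) (Algebra.subset_adjoin (by simp))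
      (Algebra.subset_adjoin (by simp)) (d 0) (d 1) (d 3) (d 4) (d 5) (d 6) hw
    have hh₁ : h₁ ∈ A := Algebra.subset_adjoin (by simp)
    have hh₀ : h₀ ∈ A := Algebra.subset_adjoin (by simp)
    convert A.mul_mem (A.algebraMap_mem (coeff d P))
      (A.mul_mem hprod (A.mul_mem (A.pow_mem hh₁ (d 2)) (A.pow_mem hh₀ (d 7)))) using 1
    rw [algebraMap_eq]
    ring
  · intro hP t ht
    have huv : (C t : MvPolynomial (Fin 8) ℂ) * C t⁻¹ = 1 := by
      rw [← C_mul, mul_inv_cancel₀ ht, C_1]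
    refine Algebra.adjoin_le (S := AlgHom.equalizer (torusAct t) (AlgHom.id ℂ _)) ?_ hP
    intro g hg
    simp only [Set.mem_insert_iff, Set.mem_singleton_iff] at hg
    simp only [SetLike.mem_coe, AlgHom.mem_equalizer, AlgHom.id_apply]
    rcases hg with rfl | rfl | rfl | rfl | rfl | rfl | rfl | rfl | rfl | rfl | rfl | rfl | rfl <;>
      simp only [torusAct, torusWeight, map_mul, map_pow, aeval_X, Matrix.cons_val, C_1,
        one_mul] <;>
      grind
end

section
/- Let V be the space of traceless 3×3 complex matrices, and call a function f : V → ℂ polynomial if it is given by a polynomial in the matrix entries. Define the polynomial functions I₁(A) = (3/2)(A₁₁+A₂₂), I₂(A) = (A₁₁−A₂₂)² + 4A₂₁A₁₂, I₃(A) = A₃₂A₂₃ + A₃₁A₁₃, I₄(A) = (A₁₁−A₂₂)A₂₃A₁₃ + A₁₂A₂₃² − A₂₁A₁₃², I₅(A) = (A₁₁−A₂₂)A₃₂A₃₁ + A₂₁A₃₂² − A₃₁²A₁₂, I₆(A) = (A₁₁−A₂₂)(A₃₂A₂₃ − A₃₁A₁₃) − 2(A₁₂A₂₃A₃₁ + A₂₁A₃₂A₁₃).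 Then a polynomial function f : V → ℂ satisfies f(u(g)·A·u(g)⁻¹) = f(A) for all g ∈ SL(2,ℂ) and all A ∈ V if and only if f belongs to the ℂ-subalgebra of functions generated by I₁, I₂, I₃, I₄, I₅, I₆. That is, {I₁,…,I₆} is a fundamental system of SL(2)-invariants for the adjoint action of the embedded SL(2) on sl(3,ℂ). -/
open Matrix

/-- The space `V = sl(3,ℂ)` of traceless `3×3` complex matrices. -/
abbrev sl3 : Type := {A : Matrix (Fin 3) (Fin 3) ℂ // A.trace = 0}

/-- The embedding `g ↦ u(g) = diag(g,1)` of `SL(2,ℂ)` into the `3×3` matrices. -/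
def u (g : Matrix.SpecialLinearGroup (Fin 2) ℂ) : Matrix (Fin 3) (Fin 3) ℂ :=
  !![(g : Matrix (Fin 2) (Fin 2) ℂ) 0 0, (g : Matrix (Fin 2) (Fin 2) ℂ) 0 1, 0;
     (g : Matrix (Fin 2) (Fin 2) ℂ) 1 0, (g : Matrix (Fin 2) (Fin 2) ℂ) 1 1, 0;
     0, 0, 1]

lemma det_u (g : Matrix.SpecialLinearGroup (Fin 2) ℂ) : (u g).det = 1 := by
  have h := g.prop
  rw [Matrix.det_fin_two] at h
  simp [u, Matrix.det_fin_three]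
  linear_combination h

lemma trace_conj (g : Matrix.SpecialLinearGroup (Fin 2) ℂ) (A : sl3) :
    (u g * A.1 * (u g)⁻¹).trace = 0 := by
  have h : IsUnit (u g).det := by rw [det_u]; exact isUnit_one
  rw [Matrix.trace_mul_cycle, Matrix.nonsing_inv_mul _ h, Matrix.one_mul, A.2]

/-- The adjoint action of the embedded `SL(2,ℂ)` on `sl(3,ℂ)`. -/
noncomputable def conjAct (g : Matrix.SpecialLinearGroup (Fin 2) ℂ) (A : sl3) : sl3 :=
  ⟨u g * A.1 * (u g)⁻¹, trace_conj g A⟩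

/-- A function `V → ℂ` is polynomial if it is given by a polynomial in the matrix entries. -/
def IsPolyFun (f : sl3 → ℂ) : Prop :=
  ∃ P : MvPolynomial (Fin 3 × Fin 3) ℂ,
    ∀ A : sl3, f A = MvPolynomial.eval (fun p => A.1 p.1 p.2) P

noncomputable def I₁ : sl3 → ℂ := fun A => (3 / 2) * (A.1 0 0 + A.1 1 1)
noncomputable def I₂ : sl3 → ℂ := fun A => (A.1 0 0 - A.1 1 1) ^ 2 + 4 * (A.1 1 0 * A.1 0 1)
noncomputable def I₃ : sl3 → ℂ := fun A => A.1 2 1 * A.1 1 2 + A.1 2 0 * A.1 0 2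
noncomputable def I₄ : sl3 → ℂ := fun A =>
  (A.1 0 0 - A.1 1 1) * A.1 1 2 * A.1 0 2 + A.1 0 1 * A.1 1 2 ^ 2 - A.1 1 0 * A.1 0 2 ^ 2
noncomputable def I₅ : sl3 → ℂ := fun A =>
  (A.1 0 0 - A.1 1 1) * A.1 2 1 * A.1 2 0 + A.1 1 0 * A.1 2 1 ^ 2 - A.1 2 0 ^ 2 * A.1 0 1
noncomputable def I₆ : sl3 → ℂ := fun A =>
  (A.1 0 0 - A.1 1 1) * (A.1 2 1 * A.1 1 2 - A.1 2 0 * A.1 0 2) -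
    2 * (A.1 0 1 * A.1 1 2 * A.1 2 0 + A.1 1 0 * A.1 2 1 * A.1 0 2)

/-! ### Polynomial functions on `sl3` -/

namespace IsPolyFun

lemma entry (i j : Fin 3) : IsPolyFun fun A => A.1 i j :=
  ⟨.X (i, j), fun A => by simp⟩

lemma const (c : ℂ) : IsPolyFun fun _ => c :=
  ⟨.C c, fun A => by simp⟩

lemma add {f h : sl3 → ℂ} (hf : IsPolyFun f) (hh : IsPolyFun h) : IsPolyFun (f + h) := by
  obtain ⟨P, hP⟩ := hf
  obtain ⟨Q, hQ⟩ := hh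
  exact ⟨P + Q, fun A => by simp [hP, hQ]⟩

lemma mul {f h : sl3 → ℂ} (hf : IsPolyFun f) (hh : IsPolyFun h) : IsPolyFun (f * h) := by
  obtain ⟨P, hP⟩ := hf
  obtain ⟨Q, hQ⟩ := hh
  exact ⟨P * Q, fun A => by simp [hP, hQ]⟩

lemma sub {f h : sl3 → ℂ} (hf : IsPolyFun f) (hh : IsPolyFun h) : IsPolyFun (f - h) := by
  obtain ⟨P, hP⟩ := hf
  obtain ⟨Q, hQ⟩ := hh
  exact ⟨P - Q, fun A => by simp [hP, hQ]⟩

lemma pow {f : sl3 → ℂ} (hf : IsPolyFun f) (n : ℕ) : IsPolyFun (f ^ n) := by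
  obtain ⟨P, hP⟩ := hf
  exact ⟨P ^ n, fun A => by simp [hP]⟩

end IsPolyFun

/-- The traceless matrix with the same entries as `x` outside the lower right corner. -/
def tracelessOf (x : Fin 3 × Fin 3 → ℂ) : sl3 :=
  ⟨!![x (0, 0), x (0, 1), x (0, 2); x (1, 0), x (1, 1), x (1, 2);
      x (2, 0), x (2, 1), -(x (0, 0) + x (1, 1))], by
    simp [Matrix.trace_fin_three]⟩

lemma sl3.corner (A : sl3) : A.1 2 2 = -(A.1 0 0 + A.1 1 1) := by
  have h := A.2
  rw [Matrix.trace_fin_three] at h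
  linear_combination h

lemma tracelessOf_entries (A : sl3) : tracelessOf (fun p => A.1 p.1 p.2) = A := by
  apply Subtype.ext
  ext i j
  fin_cases i <;> fin_cases j <;> simp [tracelessOf, sl3.corner]

lemma IsPolyFun.comp_tracelessOf {f : sl3 → ℂ} (hf : IsPolyFun f) :
    ∃ P : MvPolynomial (Fin 3 × Fin 3) ℂ, ∀ x, f (tracelessOf x) = MvPolynomial.eval x P := by
  obtain ⟨P, hP⟩ := hf
  refine ⟨MvPolynomial.bind₁ (fun p : Fin 3 × Fin 3 =>
    if p = (2, 2) then -(MvPolynomial.X (0, 0) + MvPolynomial.X (1, 1))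
    else MvPolynomial.X p) P, fun x => ?_⟩
  rw [hP, ← MvPolynomial.coe_aeval_eq_eval, ← MvPolynomial.coe_aeval_eq_eval,
    RingHom.coe_coe, RingHom.coe_coe, MvPolynomial.aeval_bind₁]
  congr 2
  ext ⟨i, j⟩
  fin_cases i <;> fin_cases j <;> simp [tracelessOf]

/-- The ring of polynomial functions on `sl3` has no zero divisors. -/
lemma IsPolyFun.eq_zero_of_mul_eq_zero {f h : sl3 → ℂ} (hf : IsPolyFun f) (hh : IsPolyFun h)
    (hf0 : f ≠ 0) (hfh : f * h = 0) : h = 0 := by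
  obtain ⟨P, hP⟩ := hf.comp_tracelessOf
  obtain ⟨Q, hQ⟩ := hh.comp_tracelessOf
  have hPQ : P * Q = 0 := by
    refine MvPolynomial.funext fun x => ?_
    rw [map_mul, ← hP, ← hQ, map_zero]
    exact congrFun hfh _
  rcases mul_eq_zero.1 hPQ with h0 | h0
  · refine absurd (funext fun A => ?_) hf0
    rw [← tracelessOf_entries A, hP, h0, map_zero, Pi.zero_apply]
  · funext A
    rw [← tracelessOf_entries A, hQ, h0, map_zero, Pi.zero_apply]

lemma isPolyFun_I₃ : IsPolyFun I₃ :=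
  ((IsPolyFun.entry 2 1).mul (.entry 1 2)).add ((IsPolyFun.entry 2 0).mul (.entry 0 2))

lemma I₃_ne_zero : I₃ ≠ 0 := by
  intro h
  have := congrFun h (tracelessOf fun p => if p = (2, 0) ∨ p = (0, 2) then 1 else 0)
  simp [I₃, tracelessOf] at this

/-! ### The algebra generated by the six invariants -/

/-- The algebra of functions generated by `I₁,…,I₆`. -/
noncomputable abbrev invariantAlgebra : Subalgebra ℂ (sl3 → ℂ) :=
  Algebra.adjoin ℂ {I₁, I₂, I₃, I₄, I₅, I₆}

lemma I₁_mem : I₁ ∈ invariantAlgebra := Algebra.subset_adjoin (by simp)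
lemma I₂_mem : I₂ ∈ invariantAlgebra := Algebra.subset_adjoin (by simp)
lemma I₃_mem : I₃ ∈ invariantAlgebra := Algebra.subset_adjoin (by simp)
lemma I₄_mem : I₄ ∈ invariantAlgebra := Algebra.subset_adjoin (by simp)
lemma I₅_mem : I₅ ∈ invariantAlgebra := Algebra.subset_adjoin (by simp)
lemma I₆_mem : I₆ ∈ invariantAlgebra := Algebra.subset_adjoin (by simp)

lemma isPolyFun_of_mem_invariantAlgebra {r : sl3 → ℂ} (hr : r ∈ invariantAlgebra) :
    IsPolyFun r := by
  induction hr using Algebra.adjoin_induction with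
  | mem x hx =>
    have e (i j : Fin 3) := IsPolyFun.entry i j
    have d := (e 0 0).sub (e 1 1)
    rcases hx with rfl | rfl | rfl | rfl | rfl | rfl
    · exact (IsPolyFun.const (3 / 2)).mul ((e 0 0).add (e 1 1))
    · exact (d.pow 2).add ((IsPolyFun.const 4).mul ((e 1 0).mul (e 0 1)))
    · exact isPolyFun_I₃
    · exact (((d.mul (e 1 2)).mul (e 0 2)).add ((e 0 1).mul ((e 1 2).pow 2))).sub
        ((e 1 0).mul ((e 0 2).pow 2))
    · exact (((d.mul (e 2 1)).mul (e 2 0)).add ((e 1 0).mul ((e 2 1).pow 2))).sub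
        (((e 2 0).pow 2).mul (e 0 1))
    · exact (d.mul (((e 2 1).mul (e 1 2)).sub ((e 2 0).mul (e 0 2)))).sub
        ((IsPolyFun.const 2).mul ((((e 0 1).mul (e 1 2)).mul (e 2 0)).add
          (((e 1 0).mul (e 2 1)).mul (e 0 2))))
  | algebraMap c => exact IsPolyFun.const c
  | add x y _ _ hx hy => exact hx.add hy
  | mul x y _ _ hx hy => exact hx.mul hy

lemma u_inv (g : Matrix.SpecialLinearGroup (Fin 2) ℂ) : (u g)⁻¹ = u g⁻¹ := by
  have h := g.prop
  rw [Matrix.det_fin_two] at h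
  refine Matrix.inv_eq_right_inv ?_
  ext i j
  fin_cases i <;> fin_cases j <;>
    simp [u, Matrix.mul_apply, Fin.sum_univ_three, Matrix.SpecialLinearGroup.coe_inv,
      Matrix.adjugate_fin_two] <;>
    first
      | ring1
      | linear_combination h

lemma conjAct_entry (g : Matrix.SpecialLinearGroup (Fin 2) ℂ) (A : sl3) (i j : Fin 3) :
    (conjAct g A).1 i j = ∑ k, (∑ l, u g i l * A.1 l k) * u g⁻¹ k j := by
  simp only [conjAct, u_inv, Matrix.mul_apply]

lemma invariant_of_mem_invariantAlgebra {r : sl3 → ℂ} (hr : r ∈ invariantAlgebra)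
    (g : Matrix.SpecialLinearGroup (Fin 2) ℂ) (A : sl3) : r (conjAct g A) = r A := by
  induction hr using Algebra.adjoin_induction with
  | mem x hx =>
    have h := g.prop
    rw [Matrix.det_fin_two] at h
    rcases hx with rfl | rfl | rfl | rfl | rfl | rfl
    · simp [I₁, conjAct_entry, u, Fin.sum_univ_three, Matrix.SpecialLinearGroup.coe_inv,
        Matrix.adjugate_fin_two]
      linear_combination (A.1 0 0 + A.1 1 1) * h
    · have e : I₂ (conjAct g A) = (g.1 0 0 * g.1 1 1 - g.1 0 1 * g.1 1 0) ^ 2 * I₂ A := by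
        simp [I₂, conjAct_entry, u, Fin.sum_univ_three, Matrix.SpecialLinearGroup.coe_inv,
          Matrix.adjugate_fin_two]
        ring
      rwa [h, one_pow, one_mul] at e
    · have e : I₃ (conjAct g A) = (g.1 0 0 * g.1 1 1 - g.1 0 1 * g.1 1 0) * I₃ A := by
        simp [I₃, conjAct_entry, u, Fin.sum_univ_three, Matrix.SpecialLinearGroup.coe_inv,
          Matrix.adjugate_fin_two]
        ring
      rwa [h, one_mul] at e
    · have e : I₄ (conjAct g A) = (g.1 0 0 * g.1 1 1 - g.1 0 1 * g.1 1 0) ^ 2 * I₄ A := by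
        simp [I₄, conjAct_entry, u, Fin.sum_univ_three, Matrix.SpecialLinearGroup.coe_inv,
          Matrix.adjugate_fin_two]
        ring
      rwa [h, one_pow, one_mul] at e
    · have e : I₅ (conjAct g A) = (g.1 0 0 * g.1 1 1 - g.1 0 1 * g.1 1 0) ^ 2 * I₅ A := by
        simp [I₅, conjAct_entry, u, Fin.sum_univ_three, Matrix.SpecialLinearGroup.coe_inv,
          Matrix.adjugate_fin_two]
        ring
      rwa [h, one_pow, one_mul] at e
    · have e : I₆ (conjAct g A) = (g.1 0 0 * g.1 1 1 - g.1 0 1 * g.1 1 0) ^ 2 * I₆ A := by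
        simp [I₆, conjAct_entry, u, Fin.sum_univ_three, Matrix.SpecialLinearGroup.coe_inv,
          Matrix.adjugate_fin_two]
        ring
      rwa [h, one_pow, one_mul] at e
  | algebraMap c => rfl
  | add x y _ _ hx hy => simp only [Pi.add_apply, hx, hy]
  | mul x y _ _ hx hy => simp only [Pi.mul_apply, hx, hy]

/-- The relation between the six generators. -/
lemma I₆_sq : I₆ * I₆ = I₂ * I₃ ^ 2 - 4 * (I₄ * I₅) := by
  funext A
  simp only [Pi.mul_apply, Pi.sub_apply, Pi.pow_apply, Pi.ofNat_apply, I₂, I₃, I₄, I₅, I₆]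
  ring

/-! ### Division by `I₃` -/

/-- Evaluation of a polynomial in four variables at `I₁, I₂, I₄, I₅`. -/
noncomputable abbrev evalI : MvPolynomial (Fin 4) ℂ →ₐ[ℂ] sl3 → ℂ :=
  MvPolynomial.aeval ![I₁, I₂, I₄, I₅]

lemma evalI_mem (P : MvPolynomial (Fin 4) ℂ) : evalI P ∈ invariantAlgebra := by
  induction P using MvPolynomial.induction_on with
  | C c => simp
  | add P Q hP hQ => rw [map_add]; exact add_mem hP hQ
  | mul_X P i hP =>
    rw [map_mul, MvPolynomial.aeval_X]
    refine mul_mem hP ?_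
    fin_cases i
    exacts [I₁_mem, I₂_mem, I₄_mem, I₅_mem]

lemma evalI_apply (P : MvPolynomial (Fin 4) ℂ) (A : sl3) :
    evalI P A = MvPolynomial.eval ![I₁ A, I₂ A, I₄ A, I₅ A] P := by
  induction P using MvPolynomial.induction_on with
  | C c => simp
  | add P Q hP hQ => rw [map_add, map_add, Pi.add_apply, hP, hQ]
  | mul_X P i hP =>
    rw [map_mul, map_mul, Pi.mul_apply, hP, MvPolynomial.aeval_X, MvPolynomial.eval_X]
    fin_cases i <;> rfl

lemma exists_normal_form {r : sl3 → ℂ} (hr : r ∈ invariantAlgebra) :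
    ∃ P Q : MvPolynomial (Fin 4) ℂ, ∃ c ∈ invariantAlgebra,
      r = evalI P + I₆ * evalI Q + I₃ * c := by
  induction hr using Algebra.adjoin_induction with
  | mem x hx =>
    rcases hx with rfl | rfl | rfl | rfl | rfl | rfl
    · exact ⟨.X 0, 0, 0, zero_mem _, by simp⟩
    · exact ⟨.X 1, 0, 0, zero_mem _, by simp⟩
    · exact ⟨0, 0, 1, one_mem _, by simp⟩
    · exact ⟨.X 2, 0, 0, zero_mem _, by simp⟩
    · exact ⟨.X 3, 0, 0, zero_mem _, by simp⟩
    · exact ⟨0, 1, 0, zero_mem _, by simp⟩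
  | algebraMap c => exact ⟨.C c, 0, 0, zero_mem _, by simp⟩
  | add x y _ _ hx hy =>
    obtain ⟨P, Q, c, hc, rfl⟩ := hx
    obtain ⟨P', Q', c', hc', rfl⟩ := hy
    exact ⟨P + P', Q + Q', c + c', add_mem hc hc', by simp only [map_add]; ring⟩
  | mul x y _ hy' hx hy =>
    obtain ⟨P, Q, c, hc, rfl⟩ := hx
    obtain ⟨P', Q', c', hc', rfl⟩ := hy
    refine ⟨P * P' - 4 * (.X 2 * .X 3) * (Q * Q'), P * Q' + Q * P',
      I₂ * I₃ * (evalI Q * evalI Q') + (evalI P + I₆ * evalI Q) * c' +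
        c * (evalI P' + I₆ * evalI Q' + I₃ * c'), ?_, ?_⟩
    · exact add_mem (add_mem
        (mul_mem (mul_mem I₂_mem I₃_mem) (mul_mem (evalI_mem _) (evalI_mem _)))
        (mul_mem (add_mem (evalI_mem _) (mul_mem I₆_mem (evalI_mem _))) hc')) (mul_mem hc hy')
    · have h2 : evalI (.X 2) = I₄ := by simp
      have h3 : evalI (.X 3) = I₅ := by simp
      simp only [map_add, map_sub, map_mul, h2, h3, map_ofNat]
      linear_combination (evalI Q * evalI Q') * I₆_sq

/-- Modulo `I₃`, the functions `1` and `I₆` are independent over `ℂ[I₁, I₂, I₄, I₅]`. -/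
lemma eq_zero_of_vanish_on_I₃ {P Q : MvPolynomial (Fin 4) ℂ}
    (h : ∀ A, I₃ A = 0 → evalI P A + I₆ A * evalI Q A = 0) : P = 0 ∧ Q = 0 := by
  have key (t D α β : ℂ) :
      MvPolynomial.eval ![t, D, α ^ 2, -β ^ 2] P +
        2 * α * β * MvPolynomial.eval ![t, D, α ^ 2, -β ^ 2] Q = 0 := by
    let A : sl3 := ⟨!![t / 3, -D / 4, α; -1, t / 3, 0; 0, β, -(2 * t / 3)], by
      simp [Matrix.trace_fin_three]; ring⟩
    have h1 : I₁ A = t := by simp [I₁, A]; ring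
    have h2 : I₂ A = D := by simp [I₂, A]; ring
    have h3 : I₃ A = 0 := by simp [I₃, A]
    have h4 : I₄ A = α ^ 2 := by simp [I₄, A]
    have h5 : I₅ A = -β ^ 2 := by simp [I₅, A]
    have h6 : I₆ A = 2 * α * β := by simp [I₆, A]; ring
    have := h A h3
    rwa [evalI_apply, evalI_apply, h1, h2, h4, h5, h6] at this
  have both (x : Fin 4 → ℂ) :
      MvPolynomial.eval x P = 0 ∧ x 2 * x 3 * MvPolynomial.eval x Q = 0 := by
    obtain ⟨α, hα⟩ := IsAlgClosed.exists_pow_nat_eq (x 2) (n := 2) two_pos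
    obtain ⟨β, hβ⟩ := IsAlgClosed.exists_pow_nat_eq (-x 3) (n := 2) two_pos
    have hx : x = ![x 0, x 1, α ^ 2, -β ^ 2] := by
      funext i
      fin_cases i <;> simp [hα, hβ]
    have k₁ := key (x 0) (x 1) α β
    have k₂ := key (x 0) (x 1) (-α) β
    rw [neg_sq] at k₂
    rw [← hx] at k₁ k₂
    refine ⟨by linear_combination (k₁ + k₂) / 2, ?_⟩
    have e : x 2 * x 3 = -(α * β) * (α * β) := by
      linear_combination -hα * x 3 + α ^ 2 * hβ
    rw [e]
    linear_combination -(α * β) * (k₁ - k₂) / 4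
  refine ⟨MvPolynomial.funext fun x => by rw [(both x).1, map_zero], ?_⟩
  have hQ : MvPolynomial.X 2 * MvPolynomial.X 3 * Q = 0 :=
    MvPolynomial.funext fun x => by simpa using (both x).2
  exact (mul_eq_zero.1 hQ).resolve_left
    (mul_ne_zero (MvPolynomial.X_ne_zero _) (MvPolynomial.X_ne_zero _))

lemma mem_of_I₃_mul_mem {f : sl3 → ℂ} (hf : IsPolyFun f) (h : I₃ * f ∈ invariantAlgebra) :
    f ∈ invariantAlgebra := by
  obtain ⟨P, Q, c, hc, e⟩ := exists_normal_form h
  obtain ⟨rfl, rfl⟩ : P = 0 ∧ Q = 0 := by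
    refine eq_zero_of_vanish_on_I₃ fun A hA => ?_
    have := congrFun e A
    simp only [Pi.mul_apply, Pi.add_apply, hA, zero_mul, add_zero] at this
    exact this.symm
  have h0 : I₃ * (f - c) = 0 := by
    rw [mul_sub, e]
    simp
  have := isPolyFun_I₃.eq_zero_of_mul_eq_zero
    (hf.sub (isPolyFun_of_mem_invariantAlgebra hc)) I₃_ne_zero h0
  rwa [sub_eq_zero.1 this]

lemma mem_of_I₃_pow_mul_mem (n : ℕ) {f : sl3 → ℂ} (hf : IsPolyFun f)
    (h : I₃ ^ n * f ∈ invariantAlgebra) : f ∈ invariantAlgebra := by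
  induction n with
  | zero => simpa using h
  | succ n ih =>
    refine ih (mem_of_I₃_mul_mem ((isPolyFun_I₃.pow n).mul hf) ?_)
    rwa [← mul_assoc, ← pow_succ']

/-! ### The generic slice -/

/-- A representative, depending only on the invariants, of the orbit of `A` if `I₃ A ≠ 0`. -/
noncomputable def slice (A : sl3) : Matrix (Fin 3) (Fin 3) ℂ :=
  !![I₁ A / 3 - I₆ A / (2 * I₃ A), -I₅ A / I₃ A ^ 2, 1;
     -I₄ A, I₁ A / 3 + I₆ A / (2 * I₃ A), 0;
     I₃ A, 0, -(2 / 3) * I₁ A]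

lemma exists_conjAct_eq_slice {A : sl3} (hA : I₃ A ≠ 0) :
    ∃ g : Matrix.SpecialLinearGroup (Fin 2) ℂ, (conjAct g A).1 = slice A := by
  have hs : A.1 2 1 * A.1 1 2 + A.1 2 0 * A.1 0 2 ≠ 0 := hA
  have hs' : A.1 1 2 * A.1 2 1 + A.1 0 2 * A.1 2 0 ≠ 0 := by
    convert hs using 1
    ring
  let g : Matrix.SpecialLinearGroup (Fin 2) ℂ :=
    ⟨!![A.1 2 0 / I₃ A, A.1 2 1 / I₃ A; -A.1 1 2, A.1 0 2], by
      rw [Matrix.det_fin_two]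
      simp only [I₃, Matrix.of_apply, Matrix.cons_val', Matrix.cons_val_zero,
        Matrix.cons_val_one, Matrix.cons_val_fin_one]
      field_simp
      ring⟩
  refine ⟨g, ?_⟩
  have hu : IsUnit (u g).det := by rw [det_u]; exact isUnit_one
  suffices u g * A.1 = slice A * u g by
    change u g * A.1 * (u g)⁻¹ = slice A
    rw [this, Matrix.mul_assoc, Matrix.mul_nonsing_inv _ hu, Matrix.mul_one]
  ext i j
  fin_cases i <;> fin_cases j <;>
    simp [u, g, slice, Matrix.mul_apply, Fin.sum_univ_three, sl3.corner, I₁, I₃, I₄, I₅, I₆] <;>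
    field_simp <;> ring

lemma exists_I₃_pow_mul_eval_slice_mem (P : MvPolynomial (Fin 3 × Fin 3) ℂ) :
    ∃ n : ℕ, I₃ ^ n * (fun A => MvPolynomial.eval (fun p => slice A p.1 p.2) P) ∈
      invariantAlgebra := by
  have hC (c : ℂ) {r : sl3 → ℂ} (hr : r ∈ invariantAlgebra) :
      (fun A => c * r A) ∈ invariantAlgebra := Subalgebra.smul_mem _ hr c
  have entries (p : Fin 3 × Fin 3) : I₃ ^ 3 * (fun A => slice A p.1 p.2) ∈ invariantAlgebra := by
    have h3 (n : ℕ) := pow_mem I₃_mem n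
    obtain ⟨i, j⟩ := p
    fin_cases i <;> fin_cases j
    · convert sub_mem (mul_mem (h3 3) (hC (1 / 3) I₁_mem))
        (mul_mem (h3 2) (hC (1 / 2) I₆_mem)) using 1
      funext A
      by_cases h : I₃ A = 0 <;> simp [slice, h]
      field_simp
    · convert mul_mem (h3 1) (hC (-1) I₅_mem) using 1
      funext A
      by_cases h : I₃ A = 0 <;> simp [slice, h]
      field_simp
    · convert h3 3 using 1
      funext A
      simp [slice]
    · convert mul_mem (h3 3) (hC (-1) I₄_mem) using 1
      funext A
      simp [slice]
    · convert add_mem (mul_mem (h3 3) (hC (1 / 3) I₁_mem))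
        (mul_mem (h3 2) (hC (1 / 2) I₆_mem)) using 1
      funext A
      by_cases h : I₃ A = 0 <;> simp [slice, h]
      field_simp
    · convert zero_mem invariantAlgebra using 1
      funext A
      simp [slice]
    · convert h3 4 using 1
      funext A
      simp [slice, pow_succ]
    · convert zero_mem invariantAlgebra using 1
      funext A
      simp [slice]
    · convert mul_mem (h3 3) (hC (-(2 / 3)) I₁_mem) using 1
      funext A
      simp [slice]
  induction P using MvPolynomial.induction_on with
  | C c =>
    refine ⟨0, ?_⟩
    convert Subalgebra.algebraMap_mem invariantAlgebra c using 1
    funext A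
    simp
  | add P Q hP hQ =>
    obtain ⟨m, hm⟩ := hP
    obtain ⟨n, hn⟩ := hQ
    refine ⟨m + n, ?_⟩
    convert add_mem (mul_mem (pow_mem I₃_mem n) hm) (mul_mem (pow_mem I₃_mem m) hn) using 1
    funext A
    simp only [Pi.mul_apply, Pi.add_apply, Pi.pow_apply, map_add]
    ring
  | mul_X P i hP =>
    obtain ⟨m, hm⟩ := hP
    refine ⟨m + 3, ?_⟩
    convert mul_mem hm (entries i) using 1
    funext A
    simp only [Pi.mul_apply, Pi.pow_apply, map_mul, MvPolynomial.eval_X]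
    ring

lemma mem_invariantAlgebra_of_invariant {f : sl3 → ℂ} (hf : IsPolyFun f)
    (hinv : ∀ (g : Matrix.SpecialLinearGroup (Fin 2) ℂ) (A : sl3), f (conjAct g A) = f A) :
    f ∈ invariantAlgebra := by
  obtain ⟨P, hP⟩ := id hf
  obtain ⟨n, hn⟩ := exists_I₃_pow_mul_eval_slice_mem P
  refine mem_of_I₃_pow_mul_mem (n + 1) hf ?_
  convert mul_mem I₃_mem hn using 1
  funext A
  simp only [Pi.mul_apply, Pi.pow_apply]
  by_cases hA : I₃ A = 0
  · simp [hA]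
  · obtain ⟨g, hg⟩ := exists_conjAct_eq_slice hA
    rw [← hinv g A, hP, hg]
    ring

/-- `{I₁,…,I₆}` is a fundamental system of `SL(2)`-invariants for the adjoint action of the
embedded `SL(2)` on `sl(3,ℂ)`: a polynomial function on `sl(3,ℂ)` is invariant iff it lies
in the subalgebra of functions generated by `I₁,…,I₆`. -/
theorem sl2_fundamental_invariants (f : sl3 → ℂ) (hf : IsPolyFun f) :
    (∀ (g : Matrix.SpecialLinearGroup (Fin 2) ℂ) (A : sl3), f (conjAct g A) = f A) ↔
      f ∈ Algebra.adjoin ℂ ({I₁, I₂, I₃, I₄, I₅, I₆} : Set (sl3 → ℂ)) := by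
  exact ⟨mem_invariantAlgebra_of_invariant hf,
    fun h => invariant_of_mem_invariantAlgebra h⟩
end
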